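/- arXiv:1406.1950 — 2 statements merged into one kernel-verified Lean document; each statement's English description precedes it below -/
import Mathlib

section
/- Let $\Phi$ be a complex-valued additive function defined on the dyadic cubes of a dyadic cube $I_0 \subset \mathbb R^d$. If there exists a sequence $\lambda_m \uparrow \infty$ such that $\lim_{m \to \infty} \lambda_m\, \mu\{x \in I_0 : \Phi^*(x) > \lambda_m\} = 0$ and $\Phi'(x)$ exists almost everywhere, then for every dyadic cube $I \subset I_0$ one has $\Phi(I) = \lim_{m \to \infty} \int_I [\Phi'(x)]_{\lambda_m}\,dx$. -/
open MeasureTheory Filter Topology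

noncomputable section

/-- The dyadic cube of rank `k` with corner index `n`:
`[n₁/2ᵏ,(n₁+1)/2ᵏ] × ⋯ × [n_d/2ᵏ,(n_d+1)/2ᵏ]`. -/
def dcell {d : ℕ} (k : ℕ) (n : Fin d → ℤ) : Set (Fin d → ℝ) :=
  Set.univ.pi fun j => Set.Icc ((n j : ℝ) / 2 ^ k) (((n j : ℝ) + 1) / 2 ^ k)

/-- The collection of all dyadic cubes in `ℝᵈ`. -/
def DyadicCubes (d : ℕ) : Set (Set (Fin d → ℝ)) := {I | ∃ k n, I = dcell k n}

/-- `Φ` is additive on dyadic cubes. -/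
def IsAdditive {d : ℕ} (Φ : Set (Fin d → ℝ) → ℂ) : Prop :=
  ∀ (I : Set (Fin d → ℝ)) (s : ℕ) (J : Fin s → Set (Fin d → ℝ)),
    I ∈ DyadicCubes d → (∀ i, J i ∈ DyadicCubes d) →
    (∀ i j, i ≠ j → Disjoint (interior (J i)) (interior (J j))) →
    (⋃ i, J i) = I → Φ I = ∑ i, Φ (J i)

/-- The dyadic cube of rank `k` containing `x` (unique for dyadically irrational `x`). -/
def dcellAt {d : ℕ} (k : ℕ) (x : Fin d → ℝ) : Set (Fin d → ℝ) :=
  dcell k fun j => ⌊x j * 2 ^ k⌋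

/-- The set `{x | Φ*(x) > c}`, where `Φ*(x) = sup {‖Φ I‖/μ(I) | I dyadic, x ∈ I}`. -/
def starGt {d : ℕ} (Φ : Set (Fin d → ℝ) → ℂ) (c : ℝ) : Set (Fin d → ℝ) :=
  {x | ∃ I ∈ DyadicCubes d, x ∈ I ∧ c < ‖Φ I‖ / (volume I).toReal}

/-- Truncation at level `lam`: `[f(x)]_lam`. -/
def trunc {α : Type*} (f : α → ℂ) (lam : ℝ) (x : α) : ℂ :=
  if ‖f x‖ ≤ lam then f x else 0

/-- The half-open dyadic cube of rank `k` with corner index `n`. -/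
def hcell {d : ℕ} (k : ℕ) (n : Fin d → ℤ) : Set (Fin d → ℝ) :=
  Set.univ.pi fun j => Set.Ico ((n j : ℝ) / 2 ^ k) (((n j : ℝ) + 1) / 2 ^ k)

/-- The corner index of the child, selected by `e`, of the dyadic cube with corner index `n`. -/
def childIndex {d : ℕ} (n : Fin d → ℤ) (e : Fin d → Fin 2) : Fin d → ℤ :=
  fun j => 2 * n j + ((e j : ℕ) : ℤ)

/-- The mean value of `Φ` over the dyadic cube of rank `k` containing `x`. -/
def dyadicRatio {d : ℕ} (Φ : Set (Fin d → ℝ) → ℂ) (k : ℕ) (x : Fin d → ℝ) : ℂ :=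
  Φ (dcellAt k x) / ((volume (dcellAt k x)).toReal : ℂ)

section

variable {d : ℕ}

lemma mem_hcell_iff {k : ℕ} {n : Fin d → ℤ} {x : Fin d → ℝ} :
    x ∈ hcell k n ↔ (fun j => ⌊x j * 2 ^ k⌋) = n := by
  have h2 : (0 : ℝ) < 2 ^ k := by positivity
  simp only [hcell, Set.mem_univ_pi, Set.mem_Ico, funext_iff, Int.floor_eq_iff,
    div_le_iff₀ h2, lt_div_iff₀ h2]

lemma dcellAt_eq {k : ℕ} {n : Fin d → ℤ} {x : Fin d → ℝ} (hx : x ∈ hcell k n) :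
    dcellAt k x = dcell k n := by
  rw [dcellAt, mem_hcell_iff.1 hx]

lemma hcell_subset_dcell (k : ℕ) (n : Fin d → ℤ) : hcell k n ⊆ dcell k n :=
  Set.pi_mono fun _ _ => Set.Ico_subset_Icc_self

lemma mem_dcellAt (k : ℕ) (x : Fin d → ℝ) : x ∈ dcellAt k x :=
  hcell_subset_dcell k _ (mem_hcell_iff.2 rfl)

lemma measurableSet_hcell (k : ℕ) (n : Fin d → ℤ) : MeasurableSet (hcell k n) :=
  MeasurableSet.univ_pi fun _ => measurableSet_Ico

lemma measurableSet_dcell (k : ℕ) (n : Fin d → ℤ) : MeasurableSet (dcell k n) :=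
  MeasurableSet.univ_pi fun _ => measurableSet_Icc

lemma hcell_ae_eq_dcell (k : ℕ) (n : Fin d → ℤ) :
    (hcell k n : Set (Fin d → ℝ)) =ᵐ[volume] dcell k n := by
  rw [dcell, Set.pi_univ_Icc]
  exact Measure.univ_pi_Ico_ae_eq_Icc

lemma volume_dcell (k : ℕ) (n : Fin d → ℤ) :
    volume (dcell k n) = ENNReal.ofReal ((1 / 2 ^ k) ^ d) := by
  have h (j : Fin d) : ((n j : ℝ) + 1) / 2 ^ k - (n j : ℝ) / 2 ^ k = 1 / 2 ^ k := by ring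
  simp only [dcell, volume_pi_pi, Real.volume_Icc, h, Finset.prod_const, Finset.card_univ,
    Fintype.card_fin]
  rw [ENNReal.ofReal_pow (by positivity)]

lemma volume_dcell_toReal (k : ℕ) (n : Fin d → ℤ) :
    (volume (dcell k n)).toReal = (1 / 2 ^ k) ^ d := by
  rw [volume_dcell, ENNReal.toReal_ofReal (by positivity)]

lemma volume_hcell_real (k : ℕ) (n : Fin d → ℤ) :
    volume.real (hcell k n) = (1 / 2 ^ k) ^ d := by
  rw [measureReal_congr (hcell_ae_eq_dcell k n), Measure.real, volume_dcell_toReal]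

lemma volume_hcell_ne_top (k : ℕ) (n : Fin d → ℤ) : volume (hcell k n) ≠ ⊤ := by
  rw [measure_congr (hcell_ae_eq_dcell k n), volume_dcell]
  exact ENNReal.ofReal_ne_top

lemma measurableSet_starGt (Φ : Set (Fin d → ℝ) → ℂ) (c : ℝ) : MeasurableSet (starGt Φ c) := by
  have h : starGt Φ c = ⋃ (k : ℕ), ⋃ (n : Fin d → ℤ),
      ⋃ (_ : c < ‖Φ (dcell k n)‖ / (volume (dcell k n)).toReal), dcell k n := by
    ext x
    simp only [starGt, DyadicCubes, Set.mem_ofPred_eq, Set.mem_iUnion, exists_prop]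
    constructor
    · rintro ⟨_, ⟨k, n, rfl⟩, hx, hc⟩
      exact ⟨k, n, hc, hx⟩
    · rintro ⟨k, n, hc, hx⟩
      exact ⟨_, ⟨k, n, rfl⟩, hx, hc⟩
  rw [h]
  exact MeasurableSet.iUnion fun k => MeasurableSet.iUnion fun n =>
    MeasurableSet.iUnion fun _ => measurableSet_dcell k n

lemma measurable_dyadicRatio (Φ : Set (Fin d → ℝ) → ℂ) (k : ℕ) :
    Measurable (dyadicRatio Φ k) := by
  have h : Measurable fun (x : Fin d → ℝ) (j : Fin d) => ⌊x j * 2 ^ k⌋ :=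
    measurable_pi_lambda _ fun j => ((measurable_pi_apply j).mul_const _).floor
  exact (measurable_of_countable
    fun n : Fin d → ℤ => Φ (dcell k n) / ((volume (dcell k n)).toReal : ℂ)).comp h

lemma norm_dyadicRatio_le {Φ : Set (Fin d → ℝ) → ℂ} {c : ℝ} {x : Fin d → ℝ}
    (hx : x ∉ starGt Φ c) (k : ℕ) : ‖dyadicRatio Φ k x‖ ≤ c := by
  by_contra! h
  refine hx ⟨dcellAt k x, ⟨k, _, rfl⟩, mem_dcellAt k x, ?_⟩
  rwa [dyadicRatio, norm_div, Complex.norm_real, Real.norm_of_nonneg ENNReal.toReal_nonneg] at h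

lemma norm_indicator_dyadicRatio_le {Φ : Set (Fin d → ℝ) → ℂ} {c : ℝ} (hc : 0 ≤ c)
    (k : ℕ) (x : Fin d → ℝ) : ‖(starGt Φ c)ᶜ.indicator (dyadicRatio Φ k) x‖ ≤ c := by
  by_cases hx : x ∈ starGt Φ c
  · simpa [hx] using hc
  · simpa [hx] using norm_dyadicRatio_le hx k

lemma integrableOn_indicator_dyadicRatio (Φ : Set (Fin d → ℝ) → ℂ) {c : ℝ} (hc : 0 ≤ c)
    (m k : ℕ) (n : Fin d → ℤ) :
    IntegrableOn ((starGt Φ c)ᶜ.indicator (dyadicRatio Φ m)) (hcell k n) :=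
  Measure.integrableOn_of_bounded (volume_hcell_ne_top k n)
    ((measurable_dyadicRatio Φ m).indicator
      (measurableSet_starGt Φ c).compl).aestronglyMeasurable
    (ae_of_all _ (norm_indicator_dyadicRatio_le hc m))

lemma childIndex_injective (n : Fin d → ℤ) : Function.Injective (childIndex n) := by
  intro e e' h
  ext j
  have := congrFun h j
  simp only [childIndex] at this
  omega

lemma hcell_disjoint (k : ℕ) : Pairwise (Function.onFun Disjoint (hcell (d := d) k)) := by
  intro n n' h
  rw [Function.onFun, Set.disjoint_left]
  intro x hx hx'
  exact h ((mem_hcell_iff.1 hx).symm.trans (mem_hcell_iff.1 hx'))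

lemma iUnion_hcell_childIndex (k : ℕ) (n : Fin d → ℤ) :
    ⋃ e, hcell (k + 1) (childIndex n e) = hcell k n := by
  have h2 : (0 : ℝ) < 2 ^ k := by positivity
  have h3 : (0 : ℝ) < 2 ^ k * 2 := by positivity
  ext x
  simp only [pow_succ, Set.mem_iUnion, hcell, Set.mem_univ_pi, Set.mem_Ico, div_le_iff₀ h2, lt_div_iff₀ h2,
    div_le_iff₀ h3, lt_div_iff₀ h3, childIndex]
  rw [← Classical.skolem (b := fun _ => Fin 2) (p := fun j e =>
    ((2 * n j + ((e : ℕ) : ℤ) : ℤ) : ℝ) ≤ x j * (2 ^ k * 2) ∧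
      x j * (2 ^ k * 2) < ((2 * n j + ((e : ℕ) : ℤ) : ℤ) : ℝ) + 1)]
  refine forall_congr' fun j => ?_
  rw [Fin.exists_fin_two]
  push_cast
  constructor
  · rintro (⟨h, h'⟩ | ⟨h, h'⟩) <;> simp at h h' <;> constructor <;> linarith
  · rintro ⟨h, h'⟩
    rcases lt_or_ge (x j * (2 ^ k * 2)) (2 * n j + 1) with h'' | h''
    · left; simp; constructor <;> linarith
    · right; simp; constructor <;> linarith

lemma iUnion_dcell_childIndex (k : ℕ) (n : Fin d → ℤ) :
    ⋃ e, dcell (k + 1) (childIndex n e) = dcell k n := by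
  have h2 : (0 : ℝ) < 2 ^ k := by positivity
  have h3 : (0 : ℝ) < 2 ^ k * 2 := by positivity
  ext x
  simp only [pow_succ, Set.mem_iUnion, dcell, Set.mem_univ_pi, Set.mem_Icc, div_le_iff₀ h2, le_div_iff₀ h2,
    div_le_iff₀ h3, le_div_iff₀ h3, childIndex]
  rw [← Classical.skolem (b := fun _ => Fin 2) (p := fun j e =>
    ((2 * n j + ((e : ℕ) : ℤ) : ℤ) : ℝ) ≤ x j * (2 ^ k * 2) ∧
      x j * (2 ^ k * 2) ≤ ((2 * n j + ((e : ℕ) : ℤ) : ℤ) : ℝ) + 1)]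
  refine forall_congr' fun j => ?_
  rw [Fin.exists_fin_two]
  push_cast
  constructor
  · rintro (⟨h, h'⟩ | ⟨h, h'⟩) <;> simp at h h' <;> constructor <;> linarith
  · rintro ⟨h, h'⟩
    rcases lt_or_ge (x j * (2 ^ k * 2)) (2 * n j + 1) with h'' | h''
    · left; simp; constructor <;> linarith
    · right; simp; constructor <;> linarith

lemma interior_dcell (k : ℕ) (n : Fin d → ℤ) : interior (dcell k n) =
    Set.univ.pi fun j => Set.Ioo ((n j : ℝ) / 2 ^ k) (((n j : ℝ) + 1) / 2 ^ k) := by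
  simp only [dcell, interior_pi_set Set.finite_univ, interior_Icc]

lemma disjoint_interior_dcell {k : ℕ} {n n' : Fin d → ℤ} (h : n ≠ n') :
    Disjoint (interior (dcell k n)) (interior (dcell k n')) := by
  have hsub (p : Fin d → ℤ) : interior (dcell k p) ⊆ hcell k p := by
    rw [interior_dcell]
    exact Set.pi_mono fun _ _ => Set.Ioo_subset_Ico_self
  exact (hcell_disjoint k h).mono (hsub n) (hsub n')

lemma IsAdditive.eq_sum_children {Φ : Set (Fin d → ℝ) → ℂ} (hΦ : IsAdditive Φ)
    (k : ℕ) (n : Fin d → ℤ) : Φ (dcell k n) = ∑ e, Φ (dcell (k + 1) (childIndex n e)) := by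
  let σ := Fintype.equivFin (Fin d → Fin 2)
  rw [hΦ (dcell k n) _ (fun i => dcell (k + 1) (childIndex n (σ.symm i))) ⟨k, n, rfl⟩
    (fun i => ⟨_, _, rfl⟩)
    (fun i j hij => disjoint_interior_dcell
      ((childIndex_injective n).ne (σ.symm.injective.ne hij)))
    ((σ.symm.surjective.iUnion_comp fun e => dcell (k + 1) (childIndex n e)).trans
      (iUnion_dcell_childIndex k n))]
  exact σ.symm.sum_comp fun e => Φ (dcell (k + 1) (childIndex n e))

/-- Integrals of the mean values of an additive function outside the set where its maximal function is
large differ from the function itself by a multiple of the measure of that set. -/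
lemma IsAdditive.norm_sub_setIntegral_le {Φ : Set (Fin d → ℝ) → ℂ} (hΦ : IsAdditive Φ)
    {c : ℝ} (hc : 0 ≤ c) (m : ℕ) : ∀ (k : ℕ) (n : Fin d → ℤ),
    ‖Φ (dcell k n)‖ ≤ c * volume.real (hcell k n) →
    ‖Φ (dcell k n) - ∫ x in hcell k n, (starGt Φ c)ᶜ.indicator (dyadicRatio Φ (k + m)) x‖ ≤
      2 * 2 ^ d * c * volume.real (hcell k n ∩ starGt Φ c) := by
  induction m with
  | zero =>
    intro k n h
    have hV : 0 < volume.real (hcell k n) := by rw [volume_hcell_real]; positivity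
    have hint : ∫ x in hcell k n, (starGt Φ c)ᶜ.indicator (dyadicRatio Φ (k + 0)) x =
        volume.real (hcell k n \ starGt Φ c) •
          (Φ (dcell k n) / (volume.real (hcell k n) : ℂ)) := by
      rw [setIntegral_indicator (measurableSet_starGt Φ c).compl, ← Set.sdiff_eq,
        ← setIntegral_const]
      refine setIntegral_congr_fun
        ((measurableSet_hcell k n).diff (measurableSet_starGt Φ c)) fun x hx => ?_
      simp only [dyadicRatio, add_zero, dcellAt_eq hx.1, volume_dcell_toReal, volume_hcell_real]
    have hadd := measureReal_inter_add_sdiff (s := hcell k n) (measurableSet_starGt Φ c)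
      (volume_hcell_ne_top k n)
    have heq : Φ (dcell k n) - volume.real (hcell k n \ starGt Φ c) •
          (Φ (dcell k n) / (volume.real (hcell k n) : ℂ)) =
        ((volume.real (hcell k n ∩ starGt Φ c) / volume.real (hcell k n) : ℝ) : ℂ) *
          Φ (dcell k n) := by
      rw [eq_sub_of_add_eq' hadd, Complex.real_smul]
      have : (volume.real (hcell k n) : ℂ) ≠ 0 := by exact_mod_cast hV.ne'
      push_cast
      field_simp
      ring
    rw [hint, heq, norm_mul, Complex.norm_real, Real.norm_of_nonneg (by positivity)]
    have h1 : (1 : ℝ) ≤ 2 * 2 ^ d := by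
      have : (1 : ℝ) ≤ 2 ^ d := one_le_pow₀ (by norm_num)
      linarith
    calc _ ≤ volume.real (hcell k n ∩ starGt Φ c) / volume.real (hcell k n) *
          (c * volume.real (hcell k n)) := by gcongr
      _ = 1 * (c * volume.real (hcell k n ∩ starGt Φ c)) := by field_simp
      _ ≤ 2 * 2 ^ d * (c * volume.real (hcell k n ∩ starGt Φ c)) := by gcongr
      _ = _ := by ring
  | succ m ih =>
    intro k n h
    by_cases hgood : ∀ e, ‖Φ (dcell (k + 1) (childIndex n e))‖ ≤
        c * volume.real (hcell (k + 1) (childIndex n e))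
    · have hdisj : Pairwise (Function.onFun Disjoint fun e => hcell (k + 1) (childIndex n e)) :=
        fun e e' he => hcell_disjoint (k + 1) ((childIndex_injective n).ne he)
      have hint : ∫ x in hcell k n, (starGt Φ c)ᶜ.indicator (dyadicRatio Φ (k + (m + 1))) x =
          ∑ e, ∫ x in hcell (k + 1) (childIndex n e),
            (starGt Φ c)ᶜ.indicator (dyadicRatio Φ (k + 1 + m)) x := by
        rw [← iUnion_hcell_childIndex k n, integral_iUnion_fintype
          (fun e => measurableSet_hcell _ _) hdisj
          (fun e => integrableOn_indicator_dyadicRatio Φ hc _ _ _)]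
        simp only [add_assoc, add_comm 1 m]
      have hvol : volume.real (hcell k n ∩ starGt Φ c) =
          ∑ e, volume.real (hcell (k + 1) (childIndex n e) ∩ starGt Φ c) := by
        rw [← iUnion_hcell_childIndex k n, Set.iUnion_inter]
        exact measureReal_iUnion_fintype
          (fun e e' he => (hdisj he).mono Set.inter_subset_left Set.inter_subset_left)
          (fun e => (measurableSet_hcell _ _).inter (measurableSet_starGt Φ c))
          (fun e => measure_ne_top_of_subset Set.inter_subset_left (volume_hcell_ne_top _ _))
      rw [hint, hvol, hΦ.eq_sum_children k n, ← Finset.sum_sub_distrib, Finset.mul_sum]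
      exact norm_sum_le_of_le _ fun e _ => ih (k + 1) (childIndex n e) (hgood e)
    · push Not at hgood
      obtain ⟨e, he⟩ := hgood
      have hsub : hcell (k + 1) (childIndex n e) ⊆ hcell k n ∩ starGt Φ c := by
        refine Set.subset_inter ?_ fun x hx =>
          ⟨_, ⟨k + 1, childIndex n e, rfl⟩, hcell_subset_dcell _ _ hx, ?_⟩
        · rw [← iUnion_hcell_childIndex k n]
          exact Set.subset_iUnion (fun e => hcell (k + 1) (childIndex n e)) e
        · rw [volume_hcell_real] at he
          rwa [volume_dcell_toReal, lt_div_iff₀ (by positivity)]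
      have hvol : volume.real (hcell k n) ≤
          2 ^ d * volume.real (hcell k n ∩ starGt Φ c) := by
        calc volume.real (hcell k n)
            = 2 ^ d * volume.real (hcell (k + 1) (childIndex n e)) := by
              rw [volume_hcell_real, volume_hcell_real, ← mul_pow, pow_succ]
              congr 1
              field_simp
          _ ≤ _ := by
              gcongr
              exact measure_ne_top_of_subset Set.inter_subset_left (volume_hcell_ne_top _ _)
      have hint := norm_setIntegral_le_of_norm_le_const (μ := volume)
        (volume_hcell_ne_top k n).lt_top fun x _ =>
        norm_indicator_dyadicRatio_le (Φ := Φ) hc (k + (m + 1)) x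
      calc _ ≤ c * volume.real (hcell k n) + c * volume.real (hcell k n) :=
            (norm_sub_le _ _).trans (add_le_add h hint)
        _ = 2 * c * volume.real (hcell k n) := by ring
        _ ≤ 2 * c * (2 ^ d * volume.real (hcell k n ∩ starGt Φ c)) := by gcongr
        _ = _ := by ring

lemma measurable_truncation (c : ℝ) : Measurable (trunc (id : ℂ → ℂ) c) :=
  Measurable.ite (measurableSet_le measurable_norm measurable_const) measurable_id
    measurable_const

lemma norm_trunc_le {α : Type*} (f : α → ℂ) {c : ℝ} (hc : 0 ≤ c) (x : α) :
    ‖trunc f c x‖ ≤ c := by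
  unfold trunc
  split_ifs with h
  · exact h
  · simpa using hc

/-- The truncated derivative integrates to the additive function up to a multiple of the measure
of the set where the maximal function exceeds the truncation level. -/
lemma IsAdditive.norm_sub_setIntegral_trunc_le {Φ : Set (Fin d → ℝ) → ℂ} (hΦ : IsAdditive Φ)
    {c : ℝ} (hc : 0 ≤ c) {k : ℕ} {n : Fin d → ℤ} {f : (Fin d → ℝ) → ℂ}
    (hf : ∀ᵐ x ∂(volume.restrict (hcell k n)),
      Tendsto (fun m => dyadicRatio Φ m x) atTop (𝓝 (f x)))
    (h : ‖Φ (dcell k n)‖ ≤ c * volume.real (hcell k n)) :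
    ‖Φ (dcell k n) - ∫ x in hcell k n, trunc f c x‖ ≤
      (2 * 2 ^ d + 1) * (c * volume.real (hcell k n ∩ starGt Φ c)) := by
  have : IsFiniteMeasure (volume.restrict (hcell k n)) :=
    isFiniteMeasure_restrict.2 (volume_hcell_ne_top k n)
  have hE := measurableSet_starGt Φ c
  have hmeas : AEMeasurable f (volume.restrict (hcell k n)) :=
    aemeasurable_of_tendsto_metrizable_ae atTop
      (fun m => (measurable_dyadicRatio Φ m).aemeasurable) hf
  have hint : IntegrableOn (trunc f c) (hcell k n) :=
    Integrable.of_bound ((measurable_truncation c).comp_aemeasurable hmeas).aestronglyMeasurable c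
      (ae_of_all _ (norm_trunc_le f hc))
  have hlim : Tendsto (fun m => ∫ x in hcell k n,
      (starGt Φ c)ᶜ.indicator (dyadicRatio Φ (k + m)) x) atTop
      (𝓝 (∫ x in hcell k n, (starGt Φ c)ᶜ.indicator (trunc f c) x)) := by
    refine tendsto_integral_of_dominated_convergence (fun _ => c)
      (fun m => ((measurable_dyadicRatio Φ _).indicator hE.compl).aestronglyMeasurable)
      (integrable_const c)
      (fun m => ae_of_all _ (norm_indicator_dyadicRatio_le hc _)) ?_
    filter_upwards [hf] with x hx
    by_cases hxE : x ∈ starGt Φ c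
    · simp [hxE]
    · have hle : ‖f x‖ ≤ c := le_of_tendsto' hx.norm fun m => norm_dyadicRatio_le hxE m
      simpa [hxE, trunc, hle, add_comm k, Function.comp_def] using
        hx.comp (tendsto_add_atTop_nat k)
  have hle := le_of_tendsto' (tendsto_const_nhds.sub hlim).norm
    fun m => hΦ.norm_sub_setIntegral_le hc m k n h
  have hsplit : ∫ x in hcell k n, trunc f c x =
      (∫ x in hcell k n, (starGt Φ c)ᶜ.indicator (trunc f c) x) +
        ∫ x in hcell k n ∩ starGt Φ c, trunc f c x := by
    rw [setIntegral_indicator hE.compl, ← Set.sdiff_eq, add_comm,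
      integral_inter_add_sdiff hE hint]
  have hbad : ‖∫ x in hcell k n ∩ starGt Φ c, trunc f c x‖ ≤
      c * volume.real (hcell k n ∩ starGt Φ c) :=
    norm_setIntegral_le_of_norm_le_const
      (measure_lt_top_of_subset Set.inter_subset_left (volume_hcell_ne_top k n))
      fun x _ => norm_trunc_le f hc x
  rw [hsplit, ← sub_sub]
  calc _ ≤ _ := norm_sub_le _ _
    _ ≤ _ := add_le_add hle hbad
    _ = _ := by ring

end

/-- **Theorem (Gevorkyan).**  Let `Φ` be a complex-valued additive function on the dyadic
cubes of a dyadic cube `I₀ ⊆ ℝᵈ`.  If there is a sequence `λ_m ↑ ∞` such that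
`λ_m · μ{x ∈ I₀ : Φ*(x) > λ_m} → 0` and `Φ'(x)` exists a.e. (with value `f x`), then for
every dyadic cube `I ⊆ I₀`, `Φ(I) = lim_m ∫_I [Φ'(x)]_{λ_m} dx`. -/
theorem reconstruction_additive_function_dyadic
    (d : ℕ) (Φ : Set (Fin d → ℝ) → ℂ) (hΦ : IsAdditive Φ)
    (I0 : Set (Fin d → ℝ)) (hI0 : I0 ∈ DyadicCubes d)
    (lam : ℕ → ℝ) (hmono : Monotone lam) (htop : Tendsto lam atTop atTop)
    (hsmall : Tendsto (fun m => lam m * (volume (I0 ∩ starGt Φ (lam m))).toReal)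
      atTop (𝓝 0))
    (f : (Fin d → ℝ) → ℂ)
    (hderiv : ∀ᵐ x ∂(volume.restrict I0),
      Tendsto (fun k => Φ (dcellAt k x) / ((volume (dcellAt k x)).toReal : ℂ))
        atTop (𝓝 (f x)))
    (I : Set (Fin d → ℝ)) (hI : I ∈ DyadicCubes d) (hsub : I ⊆ I0) :
    Tendsto (fun m => ∫ x in I, trunc f (lam m) x) atTop (𝓝 (Φ I)) := by
  obtain ⟨k, n, rfl⟩ := hI
  obtain ⟨k0, n0, rfl⟩ := hI0
  have hsub' : hcell k n ⊆ dcell k0 n0 := (hcell_subset_dcell k n).trans hsub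
  have hf : ∀ᵐ x ∂(volume.restrict (hcell k n)),
      Tendsto (fun m => dyadicRatio Φ m x) atTop (𝓝 (f x)) :=
    ae_restrict_of_ae_restrict_of_subset hsub' hderiv
  have hV : 0 < volume.real (hcell k n) := by rw [volume_hcell_real]; positivity
  rw [tendsto_iff_norm_sub_tendsto_zero]
  have hbound := hsmall.const_mul (2 * 2 ^ d + 1)
  rw [mul_zero] at hbound
  refine squeeze_zero' (Eventually.of_forall fun m => norm_nonneg _) ?_ hbound
  filter_upwards [htop.eventually_ge_atTop 0,
    htop.eventually_ge_atTop (‖Φ (dcell k n)‖ / volume.real (hcell k n))] with m hm hm'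
  rw [norm_sub_rev, ← setIntegral_congr_set (hcell_ae_eq_dcell k n)]
  refine (hΦ.norm_sub_setIntegral_trunc_le hm hf ((div_le_iff₀ hV).1 hm')).trans ?_
  have hfin : volume (dcell k0 n0 ∩ starGt Φ (lam m)) ≠ ⊤ :=
    measure_ne_top_of_subset Set.inter_subset_left
      (by rw [volume_dcell]; exact ENNReal.ofReal_ne_top)
  gcongr
  exact ENNReal.toReal_mono hfin (measure_mono (Set.inter_subset_inter_left _ hsub'))
end
end

section
/- Let $k_n = n(n-1)/2$, $\alpha(n,i) = (1-2^{-(i-1)})2^{k_n+i}+1$, let $S^*$ be the majorant of partial sums of the Haar series $\sum_{n=1}^\infty \sum_{i=1}^n 2^{(k_n+i)/2} \chi_{k_n+i}^{(\alpha(n,i))}(x)$, and let $h_m(x) = 2^{k_m+j+1}$ for $x \in [1-2^{-(j-1)}, 1-2^{-j})$, $j = 1,\dots,m$, $h_m(x) = 2^m$ for $x \in [1-2^{-m},1]$. Then $\int_{\{x \in [0,1] : S^*(x) > h_m(x)\}} h_m(x)\,dx \le 2m \cdot 2^{-m} + 2^{m+1} \cdot 2^{-k_{m+1}}$; in particular this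 integral tends to $0$ as $m \to \infty$. -/
open MeasureTheory Filter Topology

noncomputable section

/-- `k_n = n(n-1)/2`. -/
def ksq (n : ℕ) : ℕ := n * (n - 1) / 2

/-- `α(n,i) = (1 - 2^{-(i-1)}) 2^{k_n+i} + 1 = 2^{k_n+i} - 2^{k_n+1} + 1`. -/
def alph (n i : ℕ) : ℕ := 2 ^ (ksq n + i) - 2 ^ (ksq n + 1) + 1

/-- The Haar function `χ_k^{(i)}` (two-index notation, `n = 2^k + i`, `1 ≤ i ≤ 2^k`):
`2^{k/2}` on `((i-1)/2^k, (2i-1)/2^{k+1})`, `-2^{k/2}` on `((2i-1)/2^{k+1}, i/2^k)`, `0`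
outside `[(i-1)/2^k, i/2^k]` (values at the finitely many break points are immaterial). -/
def haar (k i : ℕ) (x : ℝ) : ℝ :=
  if ((i : ℝ) - 1) / 2 ^ k < x ∧ x < (2 * (i : ℝ) - 1) / 2 ^ (k + 1) then
    (2 : ℝ) ^ ((k : ℝ) / 2)
  else if (2 * (i : ℝ) - 1) / 2 ^ (k + 1) < x ∧ x < (i : ℝ) / 2 ^ k then
    -((2 : ℝ) ^ ((k : ℝ) / 2))
  else 0

/-- The `N`-th partial sum `∑_{n ≤ N} a_n χ_n(x)` (single-index enumeration) of the Haar
series `∑_{n=1}^∞ ∑_{i=1}^n 2^{(k_n+i)/2} χ_{k_n+i}^{(α(n,i))}`: its terms are the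
functions `2^{(k_n+i)/2} χ_{k_n+i}^{(α(n,i))}` with single index `2^{k_n+i} + α(n,i)`, and
all other coefficients vanish.  (Terms with outer index `n > N` have single index
`≥ 2^{k_n+1} + 1 > N`, so the outer cut-off at `N` loses nothing.) -/
def pSum (N : ℕ) (x : ℝ) : ℝ :=
  ∑ n ∈ Finset.Icc 1 N, ∑ i ∈ Finset.Icc 1 n,
    if 2 ^ (ksq n + i) + alph n i ≤ N then
      (2 : ℝ) ^ ((ksq n + i : ℝ) / 2) * haar (ksq n + i) (alph n i) x
    else 0

/-- The function `h_m` of the example: `h_m(x) = 2^{k_m+j+1}` for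
`x ∈ [1-2^{-(j-1)}, 1-2^{-j})`, `j = 1, …, m`, and `h_m(x) = 2^m` for `x ∈ [1-2^{-m},1]`. -/
def hfun (m : ℕ) (x : ℝ) : ℝ :=
  if 1 - 1 / 2 ^ m ≤ x then 2 ^ m
  else ∑ j ∈ Finset.Icc 1 m,
    if 1 - 1 / 2 ^ (j - 1) ≤ x ∧ x < 1 - 1 / 2 ^ j then (2 : ℝ) ^ (ksq m + j + 1) else 0

lemma ksq_succ (n : ℕ) : ksq (n + 1) = ksq n + n := Nat.triangle_succ n

lemma monotone_ksq : Monotone ksq :=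
  monotone_nat_of_le_succ fun n => by rw [ksq_succ]; omega

lemma alph_cast (n p : ℕ) :
    (alph n (p + 1) : ℝ) = 2 ^ (ksq n + (p + 1)) - 2 ^ (ksq n + 1) + 1 := by
  have h : 2 ^ (ksq n + 1) ≤ 2 ^ (ksq n + (p + 1)) := Nat.pow_le_pow_right two_pos (by omega)
  unfold alph
  push_cast [Nat.cast_sub h]
  ring

lemma abs_haar_le (k i : ℕ) (x : ℝ) : |haar k i x| ≤ (2 : ℝ) ^ ((k : ℝ) / 2) := by
  have h : (0 : ℝ) ≤ (2 : ℝ) ^ ((k : ℝ) / 2) := by positivity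
  unfold haar
  split_ifs <;> simp [abs_of_nonneg h, h]

lemma haar_ne_zero {k i : ℕ} {x : ℝ} (h : haar k i x ≠ 0) :
    ((i : ℝ) - 1) / 2 ^ k < x ∧ x < (i : ℝ) / 2 ^ k := by
  have h1 : ((i : ℝ) - 1) / 2 ^ k < (2 * (i : ℝ) - 1) / 2 ^ (k + 1) := by
    rw [pow_succ, div_lt_div_iff₀ (by positivity) (by positivity)]
    nlinarith [show (0 : ℝ) < 2 ^ k by positivity]
  have h2 : (2 * (i : ℝ) - 1) / 2 ^ (k + 1) < (i : ℝ) / 2 ^ k := by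
    rw [pow_succ, div_lt_div_iff₀ (by positivity) (by positivity)]
    nlinarith [show (0 : ℝ) < 2 ^ k by positivity]
  unfold haar at h
  split_ifs at h with h3 h4
  · exact ⟨h3.1, h3.2.trans h2⟩
  · exact ⟨h1.trans h4.1, h4.2⟩
  · exact absurd rfl h

/-- The interval of length `2^{-(k_n+i)}` to the right of `1 - 2^{-(i-1)}`, which supports
`χ_{k_n+i}^{(α(n,i))}`. -/
def haarSupp (n i : ℕ) : Set ℝ :=
  Set.Ioo (1 - 1 / 2 ^ (i - 1)) (1 - 1 / 2 ^ (i - 1) + 1 / 2 ^ (ksq n + i))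

lemma mem_haarSupp {n i : ℕ} (hi : 1 ≤ i) {x : ℝ}
    (h : haar (ksq n + i) (alph n i) x ≠ 0) : x ∈ haarSupp n i := by
  obtain ⟨p, rfl⟩ := Nat.exists_eq_add_of_le' hi
  obtain ⟨h1, h2⟩ := haar_ne_zero h
  rw [alph_cast] at h1 h2
  have e : (2 : ℝ) ^ (ksq n + (p + 1)) = 2 ^ (ksq n + 1) * 2 ^ p := by ring
  have e1 : (1 : ℝ) - 1 / 2 ^ p =
      (2 ^ (ksq n + (p + 1)) - 2 ^ (ksq n + 1)) / 2 ^ (ksq n + (p + 1)) := by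
    rw [e]; field_simp
  refine ⟨?_, ?_⟩
  · rw [Nat.add_sub_cancel, e1]
    simpa using h1
  · rw [Nat.add_sub_cancel, e1, ← add_div]
    exact h2

lemma haarSupp_subset {m n : ℕ} (h : m ≤ n) (i : ℕ) : haarSupp n i ⊆ haarSupp m i := by
  refine Set.Ioo_subset_Ioo_right ?_
  have : (1 : ℝ) / 2 ^ (ksq n + i) ≤ 1 / 2 ^ (ksq m + i) :=
    one_div_pow_le_one_div_pow_of_le one_le_two (by have := monotone_ksq h; omega)
  linarith

lemma haarSupp_subset_Ico (n : ℕ) {i : ℕ} (hi : 1 ≤ i) :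
    haarSupp n i ⊆ Set.Ico (1 - 1 / 2 ^ (i - 1)) (1 - 1 / 2 ^ i) := by
  refine Set.Ioo_subset_Ico_self.trans (Set.Ico_subset_Ico_right ?_)
  obtain ⟨p, rfl⟩ := Nat.exists_eq_add_of_le' hi
  have h : (1 : ℝ) / 2 ^ (ksq n + (p + 1)) ≤ 1 / 2 ^ (p + 1) :=
    one_div_pow_le_one_div_pow_of_le one_le_two (by omega)
  have e : (1 : ℝ) / 2 ^ p = 1 / 2 ^ (p + 1) + 1 / 2 ^ (p + 1) := by
    rw [pow_succ]; field_simp; norm_num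
  rw [Nat.add_sub_cancel]
  linarith

lemma measurableSet_haarSupp (n i : ℕ) : MeasurableSet (haarSupp n i) := measurableSet_Ioo

lemma volume_haarSupp (n i : ℕ) :
    volume (haarSupp n i) = ENNReal.ofReal (1 / 2 ^ (ksq n + i)) := by
  rw [haarSupp, Real.volume_Ioo, add_sub_cancel_left]

lemma abs_coeff_mul_haar_le (n i : ℕ) (x : ℝ) :
    |(2 : ℝ) ^ ((ksq n + i : ℝ) / 2) * haar (ksq n + i) (alph n i) x| ≤ 2 ^ (ksq n + i) := by
  have h := abs_haar_le (ksq n + i) (alph n i) x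
  rw [abs_mul, abs_of_nonneg (by positivity)]
  calc _ ≤ (2 : ℝ) ^ ((ksq n + i : ℝ) / 2) * (2 : ℝ) ^ (((ksq n + i : ℕ) : ℝ) / 2) := by gcongr
    _ = 2 ^ (ksq n + i) := by
      rw [← Real.rpow_add two_pos, ← Real.rpow_natCast]
      push_cast
      ring_nf

lemma eq_of_mem_Ico {i j : ℕ} {x : ℝ}
    (hi : x ∈ Set.Ico (1 - 1 / 2 ^ (i - 1) : ℝ) (1 - 1 / 2 ^ i))
    (hj : x ∈ Set.Ico (1 - 1 / 2 ^ (j - 1) : ℝ) (1 - 1 / 2 ^ j)) : i = j := by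
  have key : ∀ {a b : ℕ}, x ∈ Set.Ico (1 - 1 / 2 ^ (a - 1) : ℝ) (1 - 1 / 2 ^ a) →
      x ∈ Set.Ico (1 - 1 / 2 ^ (b - 1) : ℝ) (1 - 1 / 2 ^ b) → ¬ a < b := by
    intro a b ha hb hab
    have : (1 : ℝ) / 2 ^ (b - 1) ≤ 1 / 2 ^ a :=
      one_div_pow_le_one_div_pow_of_le one_le_two (by omega)
    linarith [ha.2, hb.1]
  exact le_antisymm (not_lt.1 (key hj hi)) (not_lt.1 (key hi hj))

lemma exists_mem_Ico {m : ℕ} {x : ℝ} (h0 : 0 ≤ x) (hx : x < 1 - 1 / 2 ^ m) :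
    ∃ j ∈ Finset.Icc 1 m, x ∈ Set.Ico (1 - 1 / 2 ^ (j - 1) : ℝ) (1 - 1 / 2 ^ j) := by
  classical
  have hex : ∃ j : ℕ, x < 1 - 1 / 2 ^ j := ⟨m, hx⟩
  have hpos : 1 ≤ Nat.find hex := by
    rw [Nat.one_le_iff_ne_zero]
    intro h
    have := Nat.find_spec hex
    rw [h] at this
    norm_num at this
    linarith
  exact ⟨Nat.find hex, Finset.mem_Icc.2 ⟨hpos, Nat.find_min' hex hx⟩,
    not_lt.1 (Nat.find_min hex (by omega)), Nat.find_spec hex⟩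

lemma hfun_of_mem_Ico {m j : ℕ} {x : ℝ} (hj : j ∈ Finset.Icc 1 m)
    (hx : x ∈ Set.Ico (1 - 1 / 2 ^ (j - 1) : ℝ) (1 - 1 / 2 ^ j)) :
    hfun m x = 2 ^ (ksq m + j + 1) := by
  have h1 : (1 : ℝ) / 2 ^ m ≤ 1 / 2 ^ j :=
    one_div_pow_le_one_div_pow_of_le one_le_two (Finset.mem_Icc.1 hj).2
  rw [hfun, if_neg (by linarith [hx.2]), Finset.sum_eq_single_of_mem j hj]
  · exact if_pos hx
  · exact fun i _ hij => if_neg fun h => hij (eq_of_mem_Ico h hx)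

lemma hfun_nonneg (m : ℕ) (x : ℝ) : 0 ≤ hfun m x := by
  unfold hfun
  split_ifs
  · positivity
  · refine Finset.sum_nonneg fun j _ => ?_
    split_ifs <;> positivity

lemma measurable_hfun (m : ℕ) : Measurable (hfun m) := by
  unfold hfun
  refine Measurable.ite measurableSet_Ici measurable_const ?_
  exact Finset.measurable_fun_sum _ fun j _ =>
    Measurable.ite measurableSet_Ico measurable_const measurable_const

lemma measurable_haar (k i : ℕ) : Measurable (haar k i) := by
  unfold haar
  exact Measurable.ite measurableSet_Ioo measurable_const
    (Measurable.ite measurableSet_Ioo measurable_const measurable_const)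

lemma measurable_pSum (N : ℕ) : Measurable (pSum N) := by
  unfold pSum
  refine Finset.measurable_fun_sum _ fun n _ => Finset.measurable_fun_sum _ fun i _ => ?_
  split_ifs
  · exact (measurable_haar _ _).const_mul _
  · exact measurable_const

lemma measurableSet_exceed (m : ℕ) :
    MeasurableSet {x ∈ Set.Icc (0 : ℝ) 1 | ∃ N, hfun m x < |pSum N x|} := by
  have : {x ∈ Set.Icc (0 : ℝ) 1 | ∃ N, hfun m x < |pSum N x|} =
      Set.Icc 0 1 ∩ ⋃ N, {x | hfun m x < |pSum N x|} := by
    ext x; simp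
  rw [this]
  exact measurableSet_Icc.inter (MeasurableSet.iUnion fun N =>
    measurableSet_lt (measurable_hfun m) (continuous_abs.measurable.comp (measurable_pSum N)))

lemma exists_mem_haarSupp {N : ℕ} {x : ℝ} (h : pSum N x ≠ 0) :
    ∃ n i, 1 ≤ i ∧ i ≤ n ∧ x ∈ haarSupp n i := by
  obtain ⟨n, -, hn⟩ := Finset.exists_ne_zero_of_sum_ne_zero h
  obtain ⟨i, hi, hne⟩ := Finset.exists_ne_zero_of_sum_ne_zero hn
  rw [Finset.mem_Icc] at hi
  have h2 : haar (ksq n + i) (alph n i) x ≠ 0 := by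
    intro h0
    simp [h0] at hne
  exact ⟨n, i, hi.1, hi.2, mem_haarSupp hi.1 h2⟩

lemma sum_two_pow_ksq_le (m : ℕ) :
    ∑ n ∈ Finset.Icc 1 m, (2 : ℝ) ^ ksq n ≤ 2 ^ (ksq m + 1) := by
  induction m with
  | zero => simp
  | succ m ih =>
    rw [Finset.sum_Icc_succ_top (by omega)]
    rcases Nat.eq_zero_or_pos m with rfl | hm
    · simp [ksq]
    · have : (2 : ℝ) ^ (ksq m + 1) ≤ 2 ^ ksq (m + 1) :=
        pow_le_pow_right₀ one_le_two (by rw [ksq_succ]; omega)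
      rw [pow_succ 2 (ksq (m + 1))]
      linarith

/-- Outside the support of the term `(m+1, j)`, every partial sum is bounded by the sum of the
moduli of the terms with outer index at most `m`. -/
lemma abs_pSum_le {m j : ℕ} {x : ℝ}
    (hx : x ∈ Set.Ico (1 - 1 / 2 ^ (j - 1) : ℝ) (1 - 1 / 2 ^ j))
    (hxs : x ∉ haarSupp (m + 1) j) (N : ℕ) : |pSum N x| ≤ 2 ^ (ksq m + j + 1) := by
  have hterm : ∀ n i, 1 ≤ i →
      |if 2 ^ (ksq n + i) + alph n i ≤ N then
        (2 : ℝ) ^ ((ksq n + i : ℝ) / 2) * haar (ksq n + i) (alph n i) x else 0| ≤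
      if i = j then (if n ≤ m then (2 : ℝ) ^ (ksq n + j) else 0) else 0 := by
    intro n i hi
    by_cases h0 : haar (ksq n + i) (alph n i) x = 0
    · simp only [h0, mul_zero, ite_self, abs_zero]
      split_ifs <;> positivity
    · have hs := mem_haarSupp hi h0
      obtain rfl := eq_of_mem_Ico (haarSupp_subset_Ico n hi hs) hx
      have hn : n ≤ m := by
        by_contra hn
        exact hxs (haarSupp_subset (by omega) i hs)
      rw [if_pos rfl, if_pos hn]
      split_ifs
      · exact abs_coeff_mul_haar_le n i x
      · rw [abs_zero]; positivity
  calc |pSum N x|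
      ≤ ∑ n ∈ Finset.Icc 1 N, ∑ i ∈ Finset.Icc 1 n,
          if i = j then (if n ≤ m then (2 : ℝ) ^ (ksq n + j) else 0) else 0 := by
        refine (Finset.abs_sum_le_sum_abs _ _).trans (Finset.sum_le_sum fun n _ => ?_)
        refine (Finset.abs_sum_le_sum_abs _ _).trans (Finset.sum_le_sum fun i hi => ?_)
        exact hterm n i (Finset.mem_Icc.1 hi).1
    _ ≤ ∑ n ∈ Finset.Icc 1 N, if n ≤ m then (2 : ℝ) ^ (ksq n + j) else 0 := by
        refine Finset.sum_le_sum fun n _ => ?_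
        rw [Finset.sum_ite_eq']
        split_ifs <;> first | exact le_rfl | positivity
    _ = ∑ n ∈ (Finset.Icc 1 N).filter (· ≤ m), (2 : ℝ) ^ (ksq n + j) := by
        rw [Finset.sum_filter]
    _ ≤ ∑ n ∈ Finset.Icc 1 m, (2 : ℝ) ^ (ksq n + j) := by
        refine Finset.sum_le_sum_of_subset_of_nonneg ?_ fun _ _ _ => by positivity
        intro n hn
        simp only [Finset.mem_filter, Finset.mem_Icc] at hn ⊢
        omega
    _ = (∑ n ∈ Finset.Icc 1 m, (2 : ℝ) ^ ksq n) * 2 ^ j := by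
        simp_rw [pow_add, Finset.sum_mul]
    _ ≤ 2 ^ (ksq m + 1) * 2 ^ j := by gcongr; exact sum_two_pow_ksq_le m
    _ = 2 ^ (ksq m + j + 1) := by ring

/-- The union of the supports of the leading terms `(i, i)` with `i > m`, which contains the
supports of all terms meeting `[1 - 2^{-m}, 1]`. -/
def tailSupp (m : ℕ) : Set ℝ := ⋃ i : ℕ, haarSupp (m + 1 + i) (m + 1 + i)

lemma measurableSet_tailSupp (m : ℕ) : MeasurableSet (tailSupp m) :=
  MeasurableSet.iUnion fun _ => measurableSet_haarSupp _ _

lemma volume_tailSupp_le (m : ℕ) :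
    volume (tailSupp m) ≤ ENNReal.ofReal (2 / 2 ^ ksq (m + 1)) := by
  have hsum : Summable fun i : ℕ => (1 / 2 ^ ksq (m + 1) : ℝ) * (1 / 2) ^ i :=
    summable_geometric_two.mul_left _
  have hval : ∑' i : ℕ, (1 / 2 ^ ksq (m + 1) : ℝ) * (1 / 2) ^ i = 2 / 2 ^ ksq (m + 1) := by
    rw [tsum_mul_left, tsum_geometric_two]; ring
  rw [← hval, ENNReal.ofReal_tsum_of_nonneg (fun _ => by positivity) hsum]
  refine (measure_iUnion_le _).trans (ENNReal.tsum_le_tsum fun i => ?_)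
  rw [volume_haarSupp]
  refine ENNReal.ofReal_le_ofReal ?_
  rw [one_div_pow, one_div_mul_one_div, ← pow_add]
  refine one_div_pow_le_one_div_pow_of_le one_le_two ?_
  have := monotone_ksq (show m + 1 ≤ m + 1 + i by omega)
  omega

lemma hfun_le_of_mem_exceed {m : ℕ} {x : ℝ}
    (hx : x ∈ {x ∈ Set.Icc (0 : ℝ) 1 | ∃ N, hfun m x < |pSum N x|}) :
    hfun m x ≤ ∑ j ∈ Finset.Icc 1 m,
        (haarSupp (m + 1) j).indicator (fun _ => (2 : ℝ) ^ (ksq m + j + 1)) x +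
      (tailSupp m).indicator (fun _ => (2 : ℝ) ^ m) x := by
  obtain ⟨⟨h0, -⟩, N, hN⟩ := hx
  have hnn : ∀ j ∈ Finset.Icc 1 m,
      0 ≤ (haarSupp (m + 1) j).indicator (fun _ => (2 : ℝ) ^ (ksq m + j + 1)) x :=
    fun j _ => Set.indicator_nonneg (fun _ _ => by positivity) x
  rcases lt_or_ge x (1 - 1 / 2 ^ m) with hlt | hge
  · obtain ⟨j, hj, hxj⟩ := exists_mem_Ico h0 hlt
    have hs : x ∈ haarSupp (m + 1) j := by
      by_contra hs
      rw [hfun_of_mem_Ico hj hxj] at hN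
      exact (abs_pSum_le hxj hs N).not_gt hN
    refine le_add_of_le_of_nonneg ?_ (Set.indicator_nonneg (fun _ _ => by positivity) x)
    refine le_trans ?_ (Finset.single_le_sum hnn hj)
    rw [hfun_of_mem_Ico hj hxj, Set.indicator_of_mem hs]
  · have hne : pSum N x ≠ 0 := by
      intro h
      rw [h, abs_zero] at hN
      exact (hfun_nonneg m x).not_gt hN
    obtain ⟨n, i, hi, hin, hs⟩ := exists_mem_haarSupp hne
    have hmi : m < i := by
      by_contra hmi
      have : (1 : ℝ) / 2 ^ m ≤ 1 / 2 ^ i :=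
        one_div_pow_le_one_div_pow_of_le one_le_two (by omega)
      linarith [(haarSupp_subset_Ico n hi hs).2]
    have ht : x ∈ tailSupp m := by
      refine Set.mem_iUnion.2 ⟨i - (m + 1), ?_⟩
      rw [Nat.add_sub_of_le hmi]
      exact haarSupp_subset hin i hs
    rw [Set.indicator_of_mem ht, hfun, if_pos hge]
    exact le_add_of_nonneg_left (Finset.sum_nonneg hnn)

lemma setIntegral_exceed_le (m : ℕ) :
    ∫ x in {x ∈ Set.Icc (0 : ℝ) 1 | ∃ N, hfun m x < |pSum N x|}, hfun m x
      ≤ 2 * (m : ℝ) / 2 ^ m + 2 ^ (m + 1) / 2 ^ ksq (m + 1) := by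
  have hg₁ : ∀ j ∈ Finset.Icc 1 m, Integrable
      ((haarSupp (m + 1) j).indicator fun _ => (2 : ℝ) ^ (ksq m + j + 1)) := fun j _ =>
    (integrable_indicator_iff (measurableSet_haarSupp _ _)).2
      (integrableOn_const (by rw [volume_haarSupp]; exact ENNReal.ofReal_ne_top))
  have hg₂ : Integrable ((tailSupp m).indicator fun _ => (2 : ℝ) ^ m) :=
    (integrable_indicator_iff (measurableSet_tailSupp m)).2
      (integrableOn_const ((volume_tailSupp_le m).trans_lt ENNReal.ofReal_lt_top).ne)
  have hg := (integrable_finsetSum _ hg₁).add hg₂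
  calc _ ≤ ∫ x in {x ∈ Set.Icc (0 : ℝ) 1 | ∃ N, hfun m x < |pSum N x|},
        (∑ j ∈ Finset.Icc 1 m,
          (haarSupp (m + 1) j).indicator (fun _ => (2 : ℝ) ^ (ksq m + j + 1)) x +
        (tailSupp m).indicator (fun _ => (2 : ℝ) ^ m) x) :=
        integral_mono_of_nonneg (Eventually.of_forall (hfun_nonneg m)) hg.integrableOn
          ((ae_restrict_mem (measurableSet_exceed m)).mono fun x hx => hfun_le_of_mem_exceed hx)
    _ ≤ ∫ x, (∑ j ∈ Finset.Icc 1 m,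
          (haarSupp (m + 1) j).indicator (fun _ => (2 : ℝ) ^ (ksq m + j + 1)) x +
        (tailSupp m).indicator (fun _ => (2 : ℝ) ^ m) x) := by
        refine setIntegral_le_integral hg (Eventually.of_forall fun x => ?_)
        exact add_nonneg
          (Finset.sum_nonneg fun j _ => Set.indicator_nonneg (fun _ _ => by positivity) x)
          (Set.indicator_nonneg (fun _ _ => by positivity) x)
    _ = ∑ j ∈ Finset.Icc 1 m, (2 / 2 ^ m : ℝ) + volume.real (tailSupp m) * 2 ^ m := by
        rw [integral_add (integrable_finsetSum _ hg₁) hg₂, integral_finsetSum _ hg₁,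
          integral_indicator_const _ (measurableSet_tailSupp m), smul_eq_mul]
        congr 1
        refine Finset.sum_congr rfl fun j _ => ?_
        rw [integral_indicator_const _ (measurableSet_haarSupp _ _), smul_eq_mul, measureReal_def,
          volume_haarSupp, ENNReal.toReal_ofReal (by positivity), ksq_succ]
        field_simp
        ring
    _ ≤ 2 * (m : ℝ) / 2 ^ m + 2 / 2 ^ ksq (m + 1) * 2 ^ m := by
        have : volume.real (tailSupp m) ≤ 2 / 2 ^ ksq (m + 1) :=
          ENNReal.toReal_le_of_le_ofReal (by positivity) (volume_tailSupp_le m)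
        rw [Finset.sum_const, Nat.card_Icc, Nat.add_sub_cancel, nsmul_eq_mul, mul_comm 2 (m : ℝ),
          mul_div_assoc]
        gcongr
    _ = _ := by ring

lemma tendsto_exceed_bound :
    Tendsto (fun m : ℕ => 2 * (m : ℝ) / 2 ^ m + 2 ^ (m + 1) / 2 ^ ksq (m + 1)) atTop (𝓝 0) := by
  have h1 : Tendsto (fun m : ℕ => 2 * ((m : ℝ) * (1 / 2) ^ m) + 2 * (1 / 2 : ℝ) ^ m)
      atTop (𝓝 0) := by
    have a := tendsto_self_mul_const_pow_of_lt_one (r := (1 / 2 : ℝ)) (by norm_num) (by norm_num)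
    have b := tendsto_pow_atTop_nhds_zero_of_lt_one (r := (1 / 2 : ℝ)) (by norm_num) (by norm_num)
    simpa using (a.const_mul 2).add (b.const_mul 2)
  refine squeeze_zero' (Eventually.of_forall fun m => by positivity) ?_ h1
  filter_upwards [eventually_ge_atTop 3] with m hm
  have hk : 2 * m ≤ ksq (m + 1) := by
    induction m, hm using Nat.le_induction with
    | base => decide
    | succ m hm ih => rw [ksq_succ]; omega
  have h2 : (2 : ℝ) ^ (m + 1) / 2 ^ ksq (m + 1) ≤ 2 * (1 / 2) ^ m := by
    rw [div_le_iff₀ (by positivity)]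
    calc (2 : ℝ) ^ (m + 1) = 2 * (1 / 2) ^ m * 2 ^ (2 * m) := by
          rw [one_div_pow, two_mul m, pow_add 2 m m]; field_simp; ring
      _ ≤ _ := by gcongr; norm_num
  have h3 : 2 * (m : ℝ) / 2 ^ m = 2 * ((m : ℝ) * (1 / 2) ^ m) := by
    rw [one_div_pow]; ring
  linarith

/-- **Example (smallness of the majorant relative to `h_m`).**  With `S*` the majorant of
the partial sums of the above Haar series,
`∫_{{x ∈ [0,1] : S*(x) > h_m(x)}} h_m ≤ 2m/2^m + 2^{m+1}/2^{k_{m+1}}`; in particular this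
integral tends to `0` as `m → ∞`. -/
theorem integral_majorant_exceeds_hfun :
    (∀ m : ℕ, 1 ≤ m →
      ∫ x in {x ∈ Set.Icc (0 : ℝ) 1 | ∃ N, hfun m x < |pSum N x|}, hfun m x
        ≤ 2 * (m : ℝ) / 2 ^ m + 2 ^ (m + 1) / 2 ^ ksq (m + 1)) ∧
    Tendsto
      (fun m => ∫ x in {x ∈ Set.Icc (0 : ℝ) 1 | ∃ N, hfun m x < |pSum N x|}, hfun m x)
      atTop (𝓝 0) := by
  refine ⟨fun m _ => setIntegral_exceed_le m, ?_⟩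
  exact squeeze_zero (fun m => integral_nonneg (hfun_nonneg m)) setIntegral_exceed_le
    tendsto_exceed_bound
end
end
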